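/- arXiv:2305.09314 — 6 statements merged into one kernel-verified Lean document; each statement's English description precedes it below -/
import Mathlib

section
/- Let N ≥ 5 and let φ be a sequential dictatorship (with dictatorial structure π) satisfying conditions (2) and (3) of the vice dictatorship definition but violating condition (1), i.e., I_t^φ is not a singleton for some t ∈ {4,…,N−2}. Then there exists a set of individuals I' with I' ∩ (I_2^φ ∪ I_3^φ) = ∅ and |I'| ≥ 3 such that: (a) there are suboutcomes σ̂¹, σ̂² ∈ S^φ(I') with π(σ̂¹) ≠ π(σ̂²), and (b) |Ō(σ̂¹) ∩ Ō(σ̂²)| ≥ 2, where S^φ(I') = {σ ∈ S^φ : I' ⊆ Ī(σ) and π(σ) ∈ I'}. -/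
/-! ## General auditability framework (Grigoryan–Möller, "A Theory of Auditability") -/

section Audit

variable {ι : Type*} [Fintype ι] [DecidableEq ι]
variable {Θi : ι → Type*} {Ωi : ι → Type*}

/-- A nonempty group `G` detects the deviation `ω ≠ φ θ`: for every feasible problem
that agrees with `θ` on `G`, some member of `G` receives an outcome different from
her outcome under `ω`. -/
def Detects (ΘS : Set (∀ i, Θi i)) (φ : (∀ i, Θi i) → (∀ i, Ωi i))
    (θ : ∀ i, Θi i) (ω : ∀ i, Ωi i) (G : Finset ι) : Prop :=
  G.Nonempty ∧ ∀ θ' ∈ ΘS, (∀ i ∈ G, θ' i = θ i) → ∃ i ∈ G, ω i ≠ φ θ' i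

/-- The minimal size of a group detecting the deviation `ω`. -/
noncomputable def minDetect (ΘS : Set (∀ i, Θi i)) (φ : (∀ i, Θi i) → (∀ i, Ωi i))
    (θ : ∀ i, Θi i) (ω : ∀ i, Ωi i) : ℕ :=
  sInf {n | ∃ G : Finset ι, G.card = n ∧ Detects ΘS φ θ ω G}

/-- The auditability index `#φ^θ`: the maximum over feasible deviations `ω ≠ φ θ`
of the minimal size of a detecting group. -/
noncomputable def auditIndex (ΩS : Set (∀ i, Ωi i)) (ΘS : Set (∀ i, Θi i))
    (φ : (∀ i, Θi i) → (∀ i, Ωi i)) (θ : ∀ i, Θi i) : ℕ :=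
  sSup {n | ∃ ω ∈ ΩS, ω ≠ φ θ ∧ minDetect ΘS φ θ ω = n}

/-- The worst-case auditability index `#φ`. -/
noncomputable def worstIndex (ΩS : Set (∀ i, Ωi i)) (ΘS : Set (∀ i, Θi i))
    (φ : (∀ i, Θi i) → (∀ i, Ωi i)) : ℕ :=
  sSup {n | ∃ θ ∈ ΘS, auditIndex ΩS ΘS φ θ = n}

end Audit

/-! ## Object allocation without money -/

section ObjectAlloc

variable {N : ℕ} {Θi : Fin N → Type*}

/-- Feasible outcomes: bijections from the `N` individuals to the `N` objects. -/
def allocΩS (N : ℕ) : Set (Fin N → Fin N) := {ω | Function.Bijective ω}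

/-- Object `o` is possible for individual `i` at type report `θi`. -/
def Possible (ΘS : Set (∀ i, Θi i)) (φ : (∀ i, Θi i) → (Fin N → Fin N))
    (i : Fin N) (θi : Θi i) (o : Fin N) : Prop :=
  ∃ θ ∈ ΘS, θ i = θi ∧ φ θ i = o

/-- Individual `i` clinches object `o` from the set `avail` at type report `θi`:
`o` is the unique object in `avail` that is possible for `i` at `θi`. -/
def Clinches (ΘS : Set (∀ i, Θi i)) (φ : (∀ i, Θi i) → (Fin N → Fin N))
    (i : Fin N) (θi : Θi i) (o : Fin N) (avail : Set (Fin N)) : Prop :=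
  o ∈ avail ∧ Possible ΘS φ i θi o ∧
    ∀ o' ∈ avail, Possible ΘS φ i θi o' → o' = o

/-- `φ` has a sequential clinching implementation at `θ`: there is an order `σ` over the
individuals such that, at each step `t`, the individual `σ t` clinches her `φ θ`-assignment
from the objects still available (those not assigned in earlier steps). -/
def SeqClinching (ΘS : Set (∀ i, Θi i)) (φ : (∀ i, Θi i) → (Fin N → Fin N))
    (θ : ∀ i, Θi i) : Prop :=
  ∃ σ : Fin N → Fin N, Function.Bijective σ ∧
    ∀ t : Fin N, Clinches ΘS φ (σ t) (θ (σ t)) (φ θ (σ t))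
      {o | ∀ s : Fin N, s < t → φ θ (σ s) ≠ o}

end ObjectAlloc

/-! ## House allocation and sequential dictatorships -/

section HouseAlloc

variable {N : ℕ}

/-- Feasible problems in the house allocation model: each type report is a strict
preference (strict total order) over the `N` objects. -/
def houseΘS (N : ℕ) : Set (Fin N → (Fin N → Fin N → Prop)) :=
  {θ | ∀ i, IsStrictTotalOrder (Fin N) (θ i)}

/-- A suboutcome, encoded as a partial assignment of objects to individuals
(`none` = unassigned). -/
abbrev Suboutcome (N : ℕ) := Fin N → Option (Fin N)

/-- A suboutcome is a partial bijection. -/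
def PartialInj (σ : Suboutcome N) : Prop :=
  ∀ i j o, σ i = some o → σ j = some o → i = j

/-- The unassigned individuals `Ī(σ)` of a suboutcome. -/
def unassignedI (σ : Suboutcome N) : Set (Fin N) := {i | σ i = none}

/-- The unassigned objects `Ō(σ)` of a suboutcome. -/
def unassignedO (σ : Suboutcome N) : Set (Fin N) := {o | ∀ i, σ i ≠ some o}

/-- A dictatorial structure: a map from suboutcomes to individuals picking an
unassigned individual at every (partially bijective) incomplete suboutcome. -/
def DictStruct (π : Suboutcome N → Fin N) : Prop :=
  ∀ σ : Suboutcome N, PartialInj σ → (∃ i, σ i = none) → σ (π σ) = none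

open Classical in
/-- The suboutcome obtained by restricting the outcome `ω` to the individuals in `I`. -/
noncomputable def subOf (ω : Fin N → Fin N) (I : Set (Fin N)) : Suboutcome N :=
  fun i => if i ∈ I then some (ω i) else none

/-- `σord` is the (ordered) run of the sequential dictatorship with dictatorial
structure `π` at problem `θ` producing the outcome `ω`: at each step `t`, the
individual `σord t` is the dictator chosen by `π` at the suboutcome formed by the
assignments of the previous steps, and she receives her most `θ`-preferred object
among those not assigned at previous steps. -/
def IsRun (π : Suboutcome N → Fin N) (θ : Fin N → (Fin N → Fin N → Prop))
    (ω : Fin N → Fin N) (σord : Fin N → Fin N) : Prop :=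
  Function.Bijective σord ∧
    ∀ t : Fin N,
      σord t = π (subOf ω {i | ∃ s : Fin N, s < t ∧ σord s = i}) ∧
      ∀ o, (∀ s : Fin N, s < t → ω (σord s) ≠ o) → o ≠ ω (σord t) →
        θ (σord t) (ω (σord t)) o

/-- `φ` is the sequential dictatorship induced by the dictatorial structure `π`. -/
def IsSeqDict (π : Suboutcome N → Fin N)
    (φ : (Fin N → (Fin N → Fin N → Prop)) → (Fin N → Fin N)) : Prop :=
  DictStruct π ∧
    ∀ θ ∈ houseΘS N, Function.Bijective (φ θ) ∧ ∃ σord, IsRun π θ (φ θ) σord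

/-- `I_t^φ` (for `t ∈ {1, …, N}`): the set of individuals who are the step-`t`
dictator for at least one problem. -/
def IstepSet (π : Suboutcome N → Fin N)
    (φ : (Fin N → (Fin N → Fin N → Prop)) → (Fin N → Fin N)) (t : ℕ) :
    Set (Fin N) :=
  {i | ∃ θ ∈ houseΘS N, ∃ σord, IsRun π θ (φ θ) σord ∧
    ∃ h : t - 1 < N, σord ⟨t - 1, h⟩ = i}

/-- `S^φ`: the set of suboutcomes that can arise at some step of the sequential
dictatorship algorithm at some problem. -/
def SPhi (π : Suboutcome N → Fin N)
    (φ : (Fin N → (Fin N → Fin N → Prop)) → (Fin N → Fin N)) :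
    Set (Suboutcome N) :=
  {s | ∃ θ ∈ houseΘS N, ∃ σord, IsRun π θ (φ θ) σord ∧
    ∃ t : ℕ, t ≤ N ∧ s = subOf (φ θ) {i | ∃ u : Fin N, (u : ℕ) < t ∧ σord u = i}}

/-- `φ` (a sequential dictatorship with dictatorial structure `π`) is a
vice dictatorship: (1) `I_t^φ` is a singleton for each `t ∈ {4, …, N−2}`;
(2) `|I_2^φ ∪ I_3^φ| ≤ 2`; (3) for any two reachable suboutcomes with the same
unassigned objects and unassigned individuals, the dictator is the same. -/
def ViceDict (π : Suboutcome N → Fin N)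
    (φ : (Fin N → (Fin N → Fin N → Prop)) → (Fin N → Fin N)) : Prop :=
  (∀ t : ℕ, 4 ≤ t → t ≤ N - 2 → ∃ i, IstepSet π φ t = {i}) ∧
  (IstepSet π φ 2 ∪ IstepSet π φ 3).ncard ≤ 2 ∧
  (∀ s ∈ SPhi π φ, ∀ s' ∈ SPhi π φ,
    unassignedO s = unassignedO s' → unassignedI s = unassignedI s' → π s = π s')

end HouseAlloc

/-- `S^φ(I')`: the reachable suboutcomes at which all members of `I'` are unassigned
and the dictator belongs to `I'`. -/
def SPhiAt {N : ℕ} (π : Suboutcome N → Fin N)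
    (φ : (Fin N → (Fin N → Fin N → Prop)) → (Fin N → Fin N))
    (I' : Finset (Fin N)) : Set (Suboutcome N) :=
  {s ∈ SPhi π φ | ↑I' ⊆ unassignedI s ∧ π s ∈ I'}

section SequentialDictatorship

variable {N : ℕ} {π : Suboutcome N → Fin N}
  {φ : (Fin N → (Fin N → Fin N → Prop)) → (Fin N → Fin N)}

/-- The individuals listed by `σ` before position `k`. -/
def firstDictators (σ : Fin N → Fin N) (k : ℕ) : Set (Fin N) :=
  {i | ∃ u : Fin N, (u : ℕ) < k ∧ σ u = i}

lemma unassignedI_subOf (ω : Fin N → Fin N) (A : Set (Fin N)) :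
    unassignedI (subOf ω A) = Aᶜ := by
  ext i
  simp [unassignedI, subOf]

lemma unassignedO_subOf (ω : Fin N → Fin N) (A : Set (Fin N)) :
    unassignedO (subOf ω A) = (ω '' A)ᶜ := by
  ext o
  simp only [unassignedO, subOf, Set.mem_ofPred_eq, Set.mem_compl_iff, Set.mem_image, not_exists,
    not_and]
  refine forall_congr' fun i => ?_
  by_cases hi : i ∈ A <;> simp [hi]

lemma ncard_firstDictators {σ : Fin N → Fin N} (hσ : Function.Injective σ) {k : ℕ} (hk : k ≤ N) :
    (firstDictators σ k).ncard = k := by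
  have h : firstDictators σ k = Set.range (σ ∘ Fin.castLE hk) := by
    ext i
    constructor
    · rintro ⟨u, hu, rfl⟩
      exact ⟨⟨u, hu⟩, rfl⟩
    · rintro ⟨u, rfl⟩
      exact ⟨Fin.castLE hk u, u.isLt, rfl⟩
  rw [h, ← Set.image_univ,
    Set.ncard_image_of_injective _ (hσ.comp (Fin.castLE_injective hk)), Set.ncard_univ,
    Nat.card_eq_fintype_card, Fintype.card_fin]

/-- The preference ranking the objects of `V` above all others, and otherwise by index. -/
def topPref (V : Set (Fin N)) (a b : Fin N) : Prop :=
  (a ∈ V ∧ b ∉ V) ∨ ((a ∈ V ↔ b ∈ V) ∧ a < b)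

lemma isStrictTotalOrder_topPref (V : Set (Fin N)) :
    IsStrictTotalOrder (Fin N) (topPref V) where
  irrefl a h := by simp [topPref] at h
  trans a b c h h' := by
    unfold topPref at *
    have : a < b → b < c → a < c := lt_trans
    tauto
  trichotomous a b h h' := by
    unfold topPref at *
    rcases lt_trichotomy a b with hab | hab | hab
    · tauto
    · exact hab
    · tauto

/-- When everybody ranks the objects of `V` on top, the first `|V|` dictators receive `V`. -/
lemma IsRun.image_firstDictators_topPref {ω σ : Fin N → Fin N} {V : Set (Fin N)}
    (hω : Function.Injective ω) (hrun : IsRun π (fun _ => topPref V) ω σ) :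
    ω '' firstDictators σ V.ncard = V := by
  have hcard : V.ncard ≤ N := by
    simpa using Set.ncard_le_card V
  refine Set.eq_of_subset_of_ncard_le ?_ ?_ (Set.toFinite _)
  · rintro _ ⟨_, ⟨u, hu, rfl⟩, rfl⟩
    have hlt : (ω '' firstDictators σ u).ncard < V.ncard := by
      rwa [Set.ncard_image_of_injective _ hω, ncard_firstDictators hrun.1.1 u.isLt.le]
    obtain ⟨v, hv, hv'⟩ := Set.exists_mem_notMem_of_ncard_lt_ncard hlt (Set.toFinite _)
    by_contra hmem
    have hpref := (hrun.2 u).2 v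
      (fun s hs heq => hv' ⟨σ s, ⟨s, hs, rfl⟩, heq⟩) (fun h => hmem (h ▸ hv))
    unfold topPref at hpref
    tauto
  · rw [Set.ncard_image_of_injective _ hω, ncard_firstDictators hrun.1.1 hcard]

lemma mem_IstepSet {θ : Fin N → (Fin N → Fin N → Prop)} (hθ : θ ∈ houseΘS N)
    {σ : Fin N → Fin N} (hrun : IsRun π θ (φ θ) σ) (u : Fin N) :
    σ u ∈ IstepSet π φ (u + 1) :=
  ⟨θ, hθ, σ, hrun, by simp, by simp⟩

/-- If `I_2 ∪ I_3` has at most two members, every run lists exactly these at steps 2 and 3. -/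
lemma IsRun.pair_eq_IstepSet (hN : 3 ≤ N)
    (h2 : (IstepSet π φ 2 ∪ IstepSet π φ 3).ncard ≤ 2)
    {θ : Fin N → (Fin N → Fin N → Prop)} (hθ : θ ∈ houseΘS N)
    {σ : Fin N → Fin N} (hrun : IsRun π θ (φ θ) σ) :
    {σ ⟨1, by omega⟩, σ ⟨2, by omega⟩} = IstepSet π φ 2 ∪ IstepSet π φ 3 := by
  refine Set.eq_of_subset_of_ncard_le ?_ ?_ (Set.toFinite _)
  · rintro i (rfl | rfl)
    · exact Or.inl (mem_IstepSet hθ hrun ⟨1, by omega⟩)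
    · exact Or.inr (mem_IstepSet hθ hrun ⟨2, by omega⟩)
  · rwa [Set.ncard_pair fun h => by simpa using hrun.1.1 h]

/-- If the dictators at all steps from 4 to `k` are determined, any two runs list the same
individuals at the first `k` steps. -/
lemma IsRun.firstDictators_subset (hN : 3 ≤ N)
    (h2 : (IstepSet π φ 2 ∪ IstepSet π φ 3).ncard ≤ 2) {k : ℕ} (hk : 3 ≤ k)
    (hsingle : ∀ t, 4 ≤ t → t ≤ k → ∃ i, IstepSet π φ t = {i})
    {θ θ' : Fin N → (Fin N → Fin N → Prop)} (hθ : θ ∈ houseΘS N) (hθ' : θ' ∈ houseΘS N)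
    {σ σ' : Fin N → Fin N} (hrun : IsRun π θ (φ θ) σ) (hrun' : IsRun π θ' (φ θ') σ') :
    firstDictators σ k ⊆ firstDictators σ' k := by
  rintro _ ⟨⟨u, huN⟩, hu, rfl⟩
  simp only at hu
  have hpair : u = 1 ∨ u = 2 → σ ⟨u, huN⟩ ∈ firstDictators σ' k := by
    intro hu'
    have hmem : σ ⟨u, huN⟩ ∈ ({σ' ⟨1, by omega⟩, σ' ⟨2, by omega⟩} : Set (Fin N)) := by
      rw [hrun'.pair_eq_IstepSet hN h2 hθ', ← hrun.pair_eq_IstepSet hN h2 hθ]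
      rcases hu' with rfl | rfl <;> simp
    rcases hmem with h | h
    · exact ⟨⟨1, by omega⟩, by simp only; omega, h.symm⟩
    · exact ⟨⟨2, by omega⟩, by simp only; omega, h.symm⟩
  by_cases h0 : u = 0
  · subst h0
    refine ⟨⟨0, huN⟩, hu, ?_⟩
    rw [(hrun.2 ⟨0, huN⟩).1, (hrun'.2 ⟨0, huN⟩).1]
    congr 1
    ext1 i
    simp [subOf, Fin.lt_def]
  by_cases h12 : u = 1 ∨ u = 2
  · exact hpair h12
  · obtain ⟨i, hi⟩ := hsingle (u + 1) (by omega) (by omega)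
    have h : σ ⟨u, huN⟩ ∈ ({i} : Set (Fin N)) := hi ▸ mem_IstepSet hθ hrun ⟨u, huN⟩
    have h' : σ' ⟨u, huN⟩ ∈ ({i} : Set (Fin N)) := hi ▸ mem_IstepSet hθ' hrun' ⟨u, huN⟩
    exact ⟨⟨u, huN⟩, hu, h'.trans h.symm⟩

end SequentialDictatorship

/-- Let `U` map `T` onto the `m`-subsets of a finite type, where `m ≥ 3`. A function on `T` that
takes equal values whenever the corresponding subsets share two elements is constant on `T`. -/
lemma eq_of_forall_two_le_ncard_inter {α S β : Type*} [Finite α] {m : ℕ} (hm : 3 ≤ m)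
    (T : Set S) (U : S → Set α) (f : S → β)
    (hU : ∀ s ∈ T, (U s).ncard = m)
    (hsurj : ∀ W : Set α, W.ncard = m → ∃ s ∈ T, U s = W)
    (hf : ∀ s ∈ T, ∀ s' ∈ T, 2 ≤ (U s ∩ U s').ncard → f s = f s')
    {s s' : S} (hs : s ∈ T) (hs' : s' ∈ T) : f s = f s' := by
  induction hn : (U s \ U s').ncard generalizing s with
  | zero =>
    rw [Set.ncard_eq_zero, Set.sdiff_eq_empty] at hn
    apply hf s hs s' hs'
    rw [Set.inter_eq_left.2 hn, hU s hs]
    omega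
  | succ n ih =>
    obtain ⟨x, hxd⟩ : (U s \ U s').Nonempty := by
      rw [← Set.ncard_pos]
      omega
    have hx := hxd.1
    have hsymm : (U s' \ U s).ncard = n + 1 := by
      rw [← hn]
      exact (Set.ncard_eq_ncard_iff_ncard_sdiff_eq_ncard_sdiff).1
        ((hU s' hs').trans (hU s hs).symm)
    obtain ⟨y, hy, hy'⟩ : (U s' \ U s).Nonempty := by
      rw [← Set.ncard_pos]
      omega
    have hdiff : (U s \ {x}).ncard = m - 1 := by
      rw [Set.ncard_sdiff_singleton_of_mem hx, hU s hs]
    have hcard : (insert y (U s \ {x})).ncard = m := by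
      rw [Set.ncard_insert_of_notMem (fun h => hy' h.1), hdiff]
      omega
    obtain ⟨r, hr, hrU⟩ := hsurj _ hcard
    have hsr : f s = f r := by
      apply hf s hs r hr
      calc 2 ≤ (U s \ {x}).ncard := by omega
        _ ≤ (U s ∩ U r).ncard := Set.ncard_le_ncard fun z hz => ⟨hz.1, hrU ▸ Or.inr hz⟩
    rw [hsr]
    apply ih hr
    have : U r \ U s' = (U s \ U s') \ {x} := by
      rw [hrU]
      ext z
      simp only [Set.mem_sdiff, Set.mem_insert_iff, Set.mem_singleton_iff]
      constructor
      · rintro ⟨rfl | h, h'⟩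
        · exact absurd hy h'
        · tauto
      · tauto
    rw [this, Set.ncard_sdiff_singleton_of_mem hxd, hn, Nat.add_sub_cancel]

/-- Lemma 1: let `N ≥ 5` and let `φ` be a sequential dictatorship
(with dictatorial structure `π`) satisfying conditions (2) and (3) of the vice
dictatorship definition but violating condition (1). Then there is a set `I'` of
individuals disjoint from `I_2^φ ∪ I_3^φ` with `|I'| ≥ 3` such that (a) there are
suboutcomes `σ̂¹, σ̂² ∈ S^φ(I')` with different dictators, and (b) at least two objects
are unassigned in both. -/
theorem statement10 (N : ℕ) (hN : 5 ≤ N)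
    (π : Suboutcome N → Fin N)
    (φ : (Fin N → (Fin N → Fin N → Prop)) → (Fin N → Fin N))
    (hφ : IsSeqDict π φ)
    (h2 : (IstepSet π φ 2 ∪ IstepSet π φ 3).ncard ≤ 2)
    (h3 : ∀ s ∈ SPhi π φ, ∀ s' ∈ SPhi π φ,
      unassignedO s = unassignedO s' → unassignedI s = unassignedI s' → π s = π s')
    (h1 : ∃ t : ℕ, 4 ≤ t ∧ t ≤ N - 2 ∧ ¬ ∃ i, IstepSet π φ t = {i}) :
    ∃ I' : Finset (Fin N),
      (↑I' ∩ (IstepSet π φ 2 ∪ IstepSet π φ 3) = (∅ : Set (Fin N))) ∧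
      3 ≤ I'.card ∧
      ∃ s1 ∈ SPhiAt π φ I', ∃ s2 ∈ SPhiAt π φ I',
        π s1 ≠ π s2 ∧ 2 ≤ (unassignedO s1 ∩ unassignedO s2).ncard := by
  classical
  obtain ⟨ht4, htN, hnot⟩ := Nat.find_spec h1
  have hmin : ∀ t < Nat.find h1, _ := fun t => Nat.find_min h1
  obtain ⟨k, hk⟩ : ∃ k, Nat.find h1 = k + 1 := ⟨Nat.find h1 - 1, by omega⟩
  rw [hk] at ht4 htN hnot hmin
  have hkN : k < N := by omega
  have hsingle : ∀ t, 4 ≤ t → t ≤ k → ∃ i, IstepSet π φ t = {i} := fun t ht htk => by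
    by_contra hcon
    exact hmin t (by omega) ⟨ht, by omega, hcon⟩
  have hθ₀ : ∀ V : Set (Fin N), (fun _ => topPref V) ∈ houseΘS N :=
    fun V _ => isStrictTotalOrder_topPref V
  obtain ⟨-, σ₀, hrun₀⟩ := hφ.2 _ (hθ₀ ∅)
  have hfirst : ∀ θ ∈ houseΘS N, ∀ σ, IsRun π θ (φ θ) σ →
      firstDictators σ k = firstDictators σ₀ k := fun θ hθ σ hrun =>
    (hrun.firstDictators_subset (by omega) h2 (by omega) hsingle hθ (hθ₀ ∅) hrun₀).antisymm
      (hrun₀.firstDictators_subset (by omega) h2 (by omega) hsingle (hθ₀ ∅) hθ hrun)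
  have hcard₀ := ncard_firstDictators hrun₀.1.1 hkN.le
  let T : Set (Suboutcome N) := {s | ∃ θ ∈ houseΘS N, ∃ σ, IsRun π θ (φ θ) σ ∧
    s = subOf (φ θ) (firstDictators σ k)}
  have hπ : ∀ {θ : Fin N → (Fin N → Fin N → Prop)} {σ : Fin N → Fin N}, IsRun π θ (φ θ) σ →
      π (subOf (φ θ) (firstDictators σ k)) = σ ⟨k, hkN⟩ :=
    fun hrun => (hrun.2 ⟨k, hkN⟩).1.symm
  have hTU : ∀ s ∈ T, (unassignedO s).ncard = N - k := by
    rintro _ ⟨θ, hθ, σ, hrun, rfl⟩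
    rw [unassignedO_subOf, Set.ncard_compl, Set.ncard_image_of_injective _ (hφ.2 θ hθ).1.1,
      ncard_firstDictators hrun.1.1 hkN.le, Nat.card_eq_fintype_card, Fintype.card_fin]
  have hsurj : ∀ W : Set (Fin N), W.ncard = N - k → ∃ s ∈ T, unassignedO s = W := by
    intro W hW
    obtain ⟨hbij, σ, hrun⟩ := hφ.2 _ (hθ₀ Wᶜ)
    refine ⟨_, ⟨_, hθ₀ Wᶜ, σ, hrun, rfl⟩, ?_⟩
    have hWk : Wᶜ.ncard = k := by
      rw [Set.ncard_compl, hW, Nat.card_eq_fintype_card, Fintype.card_fin]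
      omega
    have himage := hrun.image_firstDictators_topPref hbij.1
    rw [hWk] at himage
    rw [unassignedO_subOf, himage, compl_compl]
  obtain ⟨s₁, hs₁, s₂, hs₂, hne, hinter⟩ : ∃ s₁ ∈ T, ∃ s₂ ∈ T, π s₁ ≠ π s₂ ∧
      2 ≤ (unassignedO s₁ ∩ unassignedO s₂).ncard := by
    by_contra! hcon
    refine hnot ⟨σ₀ ⟨k, hkN⟩, Set.eq_singleton_iff_unique_mem.2
      ⟨mem_IstepSet (hθ₀ ∅) hrun₀ ⟨k, hkN⟩, ?_⟩⟩
    rintro _ ⟨θ, hθ, σ, hrun, _, rfl⟩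
    have heq := eq_of_forall_two_le_ncard_inter (by omega) T unassignedO π hTU hsurj
      (fun s hs s' hs' h => by
        by_contra hne
        exact absurd (hcon s hs s' hs' hne) (by omega))
      ⟨θ, hθ, σ, hrun, rfl⟩ ⟨_, hθ₀ ∅, σ₀, hrun₀, rfl⟩
    rwa [hπ hrun, hπ hrun₀] at heq
  have hTS : ∀ s ∈ T, s ∈ SPhiAt π φ (firstDictators σ₀ k)ᶜ.toFinset := by
    rintro _ ⟨θ, hθ, σ, hrun, rfl⟩
    refine ⟨⟨θ, hθ, σ, hrun, k, hkN.le, rfl⟩, ?_, ?_⟩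
    · rw [unassignedI_subOf, hfirst θ hθ σ hrun, Set.coe_toFinset]
    · rw [hπ hrun, Set.mem_toFinset, ← hfirst θ hθ σ hrun]
      rintro ⟨u, hu, heq⟩
      exact hu.ne (congrArg Fin.val (hrun.1.1 heq))
  refine ⟨(firstDictators σ₀ k)ᶜ.toFinset, ?_, ?_, s₁, hTS s₁ hs₁, s₂, hTS s₂ hs₂, hne, hinter⟩
  · rw [Set.coe_toFinset, ← hrun₀.pair_eq_IstepSet (by omega) h2 (hθ₀ ∅),
      ← Set.disjoint_iff_inter_eq_empty, Set.disjoint_compl_left_iff_subset]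
    rintro i (rfl | rfl)
    · exact ⟨⟨1, by omega⟩, by simp only; omega, rfl⟩
    · exact ⟨⟨2, by omega⟩, by simp only; omega, rfl⟩
  · rw [← Set.ncard_eq_toFinset_card', Set.ncard_compl, hcard₀, Nat.card_eq_fintype_card,
      Fintype.card_fin]
    omega
end

section
/- For N ≥ 2, the worst-case auditability indices of the first-price auction and the all-pay auction both equal 2, i.e., #FPA = #APA = 2. -/
/-! ## Single-object auctions -/

section Auction

variable {N : ℕ}

/-- Feasible bid profiles: nonnegative, pairwise distinct bids. -/
def aucΘS (N : ℕ) : Set (Fin N → ℝ) :=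
  {b | (∀ i, 0 ≤ b i) ∧ Function.Injective b}

/-- Feasible auction outcomes: each individual's option is a pair (receives the
object?, payment), exactly one individual receives the object, payments are
nonnegative. -/
def aucΩS (N : ℕ) : Set (Fin N → Bool × ℝ) :=
  {ω | (∃! i, (ω i).1 = true) ∧ ∀ i, 0 ≤ (ω i).2}

/-- A fixed-pay auction: each individual's payment depends only on her own bid and
on whether she receives the object. -/
def FixedPay (φ : (Fin N → ℝ) → (Fin N → Bool × ℝ)) : Prop :=
  ∀ b ∈ aucΘS N, ∀ b' ∈ aucΘS N, ∀ i, b i = b' i →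
    (φ b i).1 = (φ b' i).1 → (φ b i).2 = (φ b' i).2

/-- A dual-dictatorship: a fixed-pay auction with two individuals `i₁, i₂` and a set
of bids `B` such that, at every problem, `i₁` receives the object iff her bid lies in
`B`, and `i₂` receives the object iff `i₁`'s bid does not lie in `B`. -/
def DualDictatorship (φ : (Fin N → ℝ) → (Fin N → Bool × ℝ)) : Prop :=
  FixedPay φ ∧ ∃ (i₁ i₂ : Fin N) (B : Set ℝ), ∀ b ∈ aucΘS N,
    ((φ b i₁).1 = true ↔ b i₁ ∈ B) ∧ ((φ b i₂).1 = true ↔ b i₁ ∉ B)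

end Auction

open Classical in
/-- The first-price auction: the highest bidder receives the object and pays her bid;
everyone else pays `0`. -/
noncomputable def FPA (N : ℕ) : (Fin N → ℝ) → (Fin N → Bool × ℝ) :=
  fun b i => if ∀ j, b j ≤ b i then (true, b i) else (false, 0)

open Classical in
/-- The all-pay auction: the highest bidder receives the object; everyone pays
her own bid. -/
noncomputable def APA (N : ℕ) : (Fin N → ℝ) → (Fin N → Bool × ℝ) :=
  fun b i => if ∀ j, b j ≤ b i then (true, b i) else (false, b i)

section WinnerPaysBid

variable {N : ℕ}

open Classical in
/-- The auction in which the highest bidder receives the object and pays her bid, and a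
loser who bids `x` pays `f x`. -/
noncomputable def winnerPaysBid (N : ℕ) (f : ℝ → ℝ) : (Fin N → ℝ) → (Fin N → Bool × ℝ) :=
  fun b i => if ∀ j, b j ≤ b i then (true, b i) else (false, f (b i))

lemma winnerPaysBid_of_max (f : ℝ → ℝ) {b : Fin N → ℝ} {i : Fin N} (h : ∀ j, b j ≤ b i) :
    winnerPaysBid N f b i = (true, b i) :=
  if_pos h

lemma winnerPaysBid_of_lt (f : ℝ → ℝ) {b : Fin N → ℝ} {i j : Fin N} (h : b i < b j) :
    winnerPaysBid N f b i = (false, f (b i)) :=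
  if_neg fun hi => (hi j).not_gt h

/-- In a winner-pays-bid auction every deviation is detected by a group of at most two. -/
lemma exists_detects_card_le_two (hN : 0 < N) (f : ℝ → ℝ) {b : Fin N → ℝ} (hb : b ∈ aucΘS N)
    {ω : Fin N → Bool × ℝ} (hω : ω ∈ aucΩS N) (hne : ω ≠ winnerPaysBid N f b) :
    ∃ G : Finset (Fin N), G.card ≤ 2 ∧ Detects (aucΘS N) (winnerPaysBid N f) b ω G := by
  have : Nonempty (Fin N) := ⟨⟨0, hN⟩⟩
  obtain ⟨w, hw⟩ := Finite.exists_max b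
  have hlt : ∀ i, i ≠ w → b i < b w := fun i hi => (hw i).lt_of_ne fun h => hi (hb.2 h)
  obtain ⟨⟨v, hv, huniq⟩, -⟩ := hω
  by_cases hvw : v = w
  · subst hvw
    obtain ⟨i, hi⟩ := Function.ne_iff.mp hne
    refine ⟨{i}, by simp, Finset.singleton_nonempty i, fun b' _ hb' => ⟨i, by simp, ?_⟩⟩
    have hbi : b' i = b i := hb' i (by simp)
    intro heq
    apply hi
    by_cases hiv : i = v
    · subst hiv
      by_cases hmax : ∀ j, b' j ≤ b' i
      · rw [heq, winnerPaysBid_of_max f hmax, winnerPaysBid_of_max f hw, hbi]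
      · simp [heq, winnerPaysBid, hmax] at hv
    · by_cases hmax : ∀ j, b' j ≤ b' i
      · exact absurd (huniq i (by simp [heq, winnerPaysBid_of_max f hmax])) hiv
      · rw [heq, winnerPaysBid_of_lt f (hlt i hiv), winnerPaysBid, if_neg hmax, hbi]
  · refine ⟨{v, w}, Finset.card_le_two, ⟨v, by simp⟩, fun b' _ hb' => ⟨v, by simp, ?_⟩⟩
    have hlt' : b' v < b' w := by
      rw [hb' v (by simp), hb' w (by simp)]
      exact hlt v hvw
    intro heq
    simp [heq, winnerPaysBid_of_lt f hlt'] at hv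

lemma minDetect_winnerPaysBid_le_two (hN : 0 < N) (f : ℝ → ℝ) {b : Fin N → ℝ}
    (hb : b ∈ aucΘS N) {ω : Fin N → Bool × ℝ} (hω : ω ∈ aucΩS N)
    (hne : ω ≠ winnerPaysBid N f b) :
    minDetect (aucΘS N) (winnerPaysBid N f) b ω ≤ 2 := by
  obtain ⟨G, hcard, hG⟩ := exists_detects_card_le_two hN f hb hω hne
  refine le_trans (Nat.sInf_le ?_) hcard
  exact ⟨G, rfl, hG⟩

/-- At some bid profile there is a deviation that no single individual detects: the object
goes to the lowest bidder, who pays her bid. -/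
lemma exists_deviation_not_detects_singleton (hN : 2 ≤ N) {f : ℝ → ℝ}
    (hf : ∀ x, 0 ≤ x → 0 ≤ f x) :
    ∃ b ∈ aucΘS N, ∃ ω ∈ aucΩS N, ω ≠ winnerPaysBid N f b ∧
      ∀ i, ¬ Detects (aucΘS N) (winnerPaysBid N f) b ω {i} := by
  let z : Fin N := ⟨0, by omega⟩
  let b : Fin N → ℝ := fun i => (i : ℝ) + 1
  let ω : Fin N → Bool × ℝ := fun i => if i = z then (true, b i) else (false, f (b i))
  have hpos : ∀ i, 0 < b i := fun i => by positivity
  have hinj : Function.Injective b := fun i j h => by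
    simpa [b, Fin.ext_iff] using h
  have hle : ∀ i, b i ≤ N := fun i => by
    have := i.isLt
    simp only [b]
    exact_mod_cast this
  have hz : b z = 1 := by simp [b, z]
  refine ⟨b, ⟨fun i => (hpos i).le, hinj⟩, ω, ⟨⟨z, by simp [ω], fun i hi => ?_⟩, fun i => ?_⟩,
    fun h => ?_, fun i hi => ?_⟩
  · by_contra hiz
    simp [ω, hiz] at hi
  · by_cases hiz : i = z
    · simpa [ω, hiz] using (hpos z).le
    · simpa [ω, hiz] using hf _ (hpos i).le
  · have hlt : b z < b ⟨1, hN⟩ := by simp [b, z]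
    have := congrFun h z
    simp [ω, winnerPaysBid_of_lt f hlt] at this
  · by_cases hiz : i = z
    · subst hiz
      obtain ⟨j, hj, hne⟩ := hi.2 (fun i => (b i)⁻¹)
        ⟨fun i => (inv_pos.mpr (hpos i)).le, inv_injective.comp hinj⟩ (by simp [hz])
      obtain rfl := Finset.mem_singleton.mp hj
      apply hne
      rw [winnerPaysBid_of_max f fun k => ?_]
      · simp [ω, hz]
      · rw [hz, inv_one]
        exact inv_le_one_of_one_le₀ (by simp [b])
    · have hmem : Function.update b z (N + 1) ∈ aucΘS N := by
        refine ⟨fun k => ?_, fun k l hkl => ?_⟩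
        · by_cases hk : k = z
          · subst hk
            rw [Function.update_self]
            positivity
          · rw [Function.update_of_ne hk]
            exact (hpos k).le
        · have hk' := hle k
          have hl' := hle l
          by_cases hk : k = z <;> by_cases hl : l = z
          · rw [hk, hl]
          · rw [hk, Function.update_self, Function.update_of_ne hl] at hkl
            linarith
          · rw [hl, Function.update_self, Function.update_of_ne hk] at hkl
            linarith
          · rw [Function.update_of_ne hk, Function.update_of_ne hl] at hkl
            exact hinj hkl
      obtain ⟨j, hj, hne⟩ := hi.2 _ hmem fun k hk => by
        rw [Finset.mem_singleton.mp hk, Function.update_of_ne hiz]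
      obtain rfl := Finset.mem_singleton.mp hj
      apply hne
      have hlt : Function.update b z (N + 1) j < Function.update b z (N + 1) z := by
        rw [Function.update_of_ne hiz, Function.update_self]
        linarith [hle j]
      rw [winnerPaysBid_of_lt f hlt, Function.update_of_ne hiz]
      simp [ω, hiz]

lemma auditIndex_winnerPaysBid_le_two (hN : 0 < N) (f : ℝ → ℝ) {b : Fin N → ℝ}
    (hb : b ∈ aucΘS N) : auditIndex (aucΩS N) (aucΘS N) (winnerPaysBid N f) b ≤ 2 := by
  apply csSup_le'
  rintro _ ⟨ω, hω, hne, rfl⟩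
  exact minDetect_winnerPaysBid_le_two hN f hb hω hne

theorem worstIndex_winnerPaysBid (hN : 2 ≤ N) {f : ℝ → ℝ} (hf : ∀ x, 0 ≤ x → 0 ≤ f x) :
    worstIndex (aucΩS N) (aucΘS N) (winnerPaysBid N f) = 2 := by
  have hN' : 0 < N := by omega
  obtain ⟨b, hb, ω, hω, hne, hsingle⟩ := exists_deviation_not_detects_singleton hN hf
  have hmin : minDetect (aucΘS N) (winnerPaysBid N f) b ω = 2 := by
    refine (minDetect_winnerPaysBid_le_two hN' f hb hω hne).antisymm ?_
    obtain ⟨G₀, -, hG₀⟩ := exists_detects_card_le_two hN' f hb hω hne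
    refine le_csInf ⟨_, G₀, rfl, hG₀⟩ ?_
    rintro _ ⟨G, rfl, hG⟩
    by_contra! hlt
    have hcard : G.card = 1 := by
      have := hG.1.card_pos
      omega
    obtain ⟨i, rfl⟩ := Finset.card_eq_one.mp hcard
    exact hsingle i hG
  have haudit : auditIndex (aucΩS N) (aucΘS N) (winnerPaysBid N f) b = 2 := by
    refine IsGreatest.csSup_eq ⟨⟨ω, hω, hne, hmin⟩, ?_⟩
    rintro _ ⟨ω', hω', hne', rfl⟩
    exact minDetect_winnerPaysBid_le_two hN' f hb hω' hne'
  refine IsGreatest.csSup_eq ⟨⟨b, hb, haudit⟩, ?_⟩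
  rintro _ ⟨b', hb', rfl⟩
  exact auditIndex_winnerPaysBid_le_two hN' f hb'

end WinnerPaysBid

/-- Proposition 7: the worst-case auditability indices of the
first-price auction and of the all-pay auction both equal `2`. -/
theorem statement12 {N : ℕ} (hN : 2 ≤ N) :
    worstIndex (aucΩS N) (aucΘS N) (FPA N) = 2 ∧
    worstIndex (aucΩS N) (aucΘS N) (APA N) = 2 :=
  ⟨worstIndex_winnerPaysBid hN (f := fun _ => 0) fun _ _ => le_rfl,
    worstIndex_winnerPaysBid hN (f := fun x => x) fun _ hx => hx⟩
end

section
/- For every bid profile b ∈ Θ, the auditability index of the second-price auction at b equals N, i.e., #SPA^b = N. -/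
open Classical in
/-- The second-price auction: the highest bidder receives the object and pays the
second-highest bid; everyone else pays `0`. -/
noncomputable def SPA (N : ℕ) : (Fin N → ℝ) → (Fin N → Bool × ℝ) :=
  fun b i => if ∀ j, b j ≤ b i then (true, ⨆ j : {j : Fin N // j ≠ i}, b j)
    else (false, 0)

section Audit

variable {ι : Type*} [Fintype ι] {Θi : ι → Type*} {Ωi : ι → Type*}

theorem detects_univ [Nonempty ι] (ΘS : Set (∀ i, Θi i)) {φ : (∀ i, Θi i) → (∀ i, Ωi i)}
    {θ : ∀ i, Θi i} {ω : ∀ i, Ωi i} (hω : ω ≠ φ θ) : Detects ΘS φ θ ω Finset.univ := by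
  refine ⟨Finset.univ_nonempty, fun θ' _ h => ?_⟩
  obtain rfl : θ' = θ := funext fun i => h i (Finset.mem_univ i)
  obtain ⟨i, hi⟩ := Function.ne_iff.mp hω
  exact ⟨i, Finset.mem_univ i, hi⟩

theorem minDetect_le_card [Nonempty ι] (ΘS : Set (∀ i, Θi i)) {φ : (∀ i, Θi i) → (∀ i, Ωi i)}
    {θ : ∀ i, Θi i} {ω : ∀ i, Ωi i} (hω : ω ≠ φ θ) :
    minDetect ΘS φ θ ω ≤ Fintype.card ι :=
  Nat.sInf_le ⟨Finset.univ, Finset.card_univ, detects_univ ΘS hω⟩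

/-- A deviation that no proper group detects forces the auditability index to be maximal. -/
theorem auditIndex_eq_card [Nonempty ι] {ΩS : Set (∀ i, Ωi i)} {ΘS : Set (∀ i, Θi i)}
    {φ : (∀ i, Θi i) → (∀ i, Ωi i)} {θ : ∀ i, Θi i} {ω : ∀ i, Ωi i} (hmem : ω ∈ ΩS)
    (hω : ω ≠ φ θ) (h : ∀ G : Finset ι, Detects ΘS φ θ ω G → G = Finset.univ) :
    auditIndex ΩS ΘS φ θ = Fintype.card ι := by
  have hmin : minDetect ΘS φ θ ω = Fintype.card ι := by
    refine le_antisymm (minDetect_le_card ΘS hω) ?_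
    refine le_csInf ⟨_, Finset.univ, rfl, detects_univ ΘS hω⟩ ?_
    rintro n ⟨G, rfl, hG⟩
    rw [h G hG, Finset.card_univ]
  have hgreatest : IsGreatest {n | ∃ ω ∈ ΩS, ω ≠ φ θ ∧ minDetect ΘS φ θ ω = n}
      (Fintype.card ι) := by
    refine ⟨⟨ω, hmem, hω, hmin⟩, ?_⟩
    rintro n ⟨ω', -, hω', rfl⟩
    exact minDetect_le_card ΘS hω'
  exact hgreatest.csSup_eq

end Audit

section Auction

variable {N : ℕ}

theorem SPA_apply_of_forall_le {b : Fin N → ℝ} {i : Fin N} (h : ∀ j, b j ≤ b i) :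
    SPA N b i = (true, ⨆ j : {j : Fin N // j ≠ i}, b j) :=
  if_pos h

theorem SPA_apply_of_lt {b : Fin N → ℝ} {i j : Fin N} (h : b i < b j) :
    SPA N b i = (false, 0) :=
  if_neg fun h' => (h' j).not_gt h

/-- The outcome in which `w` receives the object at price `p` and nobody else pays. -/
def saleTo (w : Fin N) (p : ℝ) : Fin N → Bool × ℝ :=
  fun i => if i = w then (true, p) else (false, 0)

theorem saleTo_mem_aucΩS (w : Fin N) {p : ℝ} (hp : 0 ≤ p) : saleTo w p ∈ aucΩS N := by
  refine ⟨⟨w, by simp [saleTo], fun i hi => ?_⟩, fun i => ?_⟩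
  · by_contra h
    simp [saleTo, h] at hi
  · by_cases h : i = w <;> simp [saleTo, h, hp]

/-- At a profile with highest bidder `w`, the second-price auction sells to `w` at the
highest of the other bids. -/
theorem SPA_eq_saleTo {b : Fin N → ℝ} {w j : Fin N} (hw : ∀ i, i ≠ w → b i < b w)
    (hjw : j ≠ w) (hj : ∀ i, i ≠ w → b i ≤ b j) : SPA N b = saleTo w (b j) := by
  funext i
  by_cases hi : i = w
  · subst hi
    have hle : ∀ k, b k ≤ b i := fun k => by
      by_cases hk : k = i
      · rw [hk]
      · exact (hw k hk).le
    have hsup : IsGreatest (Set.range fun k : {k : Fin N // k ≠ i} => b k) (b j) :=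
      ⟨⟨⟨j, hjw⟩, rfl⟩, by rintro _ ⟨k, rfl⟩; exact hj k k.2⟩
    rw [SPA_apply_of_forall_le hle, saleTo, if_pos rfl]
    exact congrArg (Prod.mk true) hsup.csSup_eq
  · rw [SPA_apply_of_lt (hw i hi), saleTo, if_neg hi]

theorem update_mem_aucΘS {b : Fin N → ℝ} (hb : b ∈ aucΘS N) (j : Fin N) {p : ℝ} (hp : 0 ≤ p)
    (hne : ∀ i, b i ≠ p) : Function.update b j p ∈ aucΘS N := by
  refine ⟨fun i => ?_, fun i k h => ?_⟩
  · by_cases hi : i = j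
    · simpa [hi] using hp
    · simpa [hi] using hb.1 i
  · by_cases hi : i = j <;> by_cases hk : k = j
    · rw [hi, hk]
    · simp only [hi, Function.update_self, Function.update_of_ne hk] at h
      exact absurd h.symm (hne k)
    · simp only [hk, Function.update_self, Function.update_of_ne hi] at h
      exact absurd h (hne i)
    · simp only [Function.update_of_ne hi, Function.update_of_ne hk] at h
      exact hb.2 h

/-- Selling to the highest bidder strictly above the second-highest bid and strictly below her
own bid is detected only by the group of all individuals. -/
theorem eq_univ_of_detects_saleTo {b : Fin N → ℝ} (hb : b ∈ aucΘS N) {w : Fin N} {p : ℝ}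
    (hp : 0 ≤ p) (hpw : p < b w) (hlt : ∀ i, i ≠ w → b i < p) {G : Finset (Fin N)}
    (hG : Detects (aucΘS N) (SPA N) b (saleTo w p) G) : G = Finset.univ := by
  by_contra hne
  obtain ⟨j, hjG⟩ : ∃ j, j ∉ G := by
    by_contra! h
    exact hne (Finset.eq_univ_iff_forall.mpr h)
  by_cases hjw : j = w
  · obtain ⟨i, hiG, hi⟩ := hG.2 b hb fun _ _ => rfl
    have hiw : i ≠ w := by rintro rfl; exact hjG (hjw ▸ hiG)
    rw [SPA_apply_of_lt ((hlt i hiw).trans hpw), saleTo, if_neg hiw] at hi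
    exact hi rfl
  · have hnep : ∀ i, b i ≠ p := fun i => by
      by_cases hi : i = w
      · rw [hi]; exact hpw.ne'
      · exact (hlt i hi).ne
    have hle : ∀ i, i ≠ w → Function.update b j p i ≤ p := fun i hi => by
      by_cases hij : i = j
      · simp [hij]
      · simpa [hij] using (hlt i hi).le
    have hSPA : SPA N (Function.update b j p) = saleTo w p := by
      have hw : Function.update b j p w = b w := Function.update_of_ne (Ne.symm hjw) _ _
      have h := SPA_eq_saleTo (b := Function.update b j p) (w := w)
        (fun i hi => hw ▸ (hle i hi).trans_lt hpw) hjw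
        (fun i hi => by simpa using hle i hi)
      simpa using h
    obtain ⟨i, -, hi⟩ := hG.2 _ (update_mem_aucΘS hb j hp hnep) fun i hiG =>
      Function.update_of_ne (by rintro rfl; exact hjG hiG) _ _
    exact hi (congrFun hSPA i).symm

end Auction

/-- Proposition 8: at every bid profile `b`, the auditability index
of the second-price auction equals `N`. -/
theorem statement13 {N : ℕ} (hN : 2 ≤ N) (b : Fin N → ℝ) (hb : b ∈ aucΘS N) :
    auditIndex (aucΩS N) (aucΘS N) (SPA N) b = N := by
  have : Nontrivial (Fin N) := Fin.nontrivial_iff_two_le.mpr hN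
  obtain ⟨w, hw⟩ := Finite.exists_max b
  have hw' : ∀ i, i ≠ w → b i < b w := fun i hi => (hw i).lt_of_ne (hb.2.ne hi)
  have : Nonempty {j : Fin N // j ≠ w} := nonempty_subtype.mpr (exists_ne w)
  obtain ⟨⟨j, hjw⟩, hj⟩ := Finite.exists_max fun k : {k : Fin N // k ≠ w} => b k
  have hj' : ∀ i, i ≠ w → b i ≤ b j := fun i hi => hj ⟨i, hi⟩
  obtain ⟨p, hjp, hpw⟩ := exists_between (hw' j hjw)
  have hp : 0 ≤ p := (hb.1 j).trans hjp.le
  have hdev : saleTo w p ≠ SPA N b := fun h => by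
    have h' := congrFun (h.trans (SPA_eq_saleTo hw' hjw hj')) w
    simp only [saleTo, if_true, Prod.mk.injEq, true_and] at h'
    exact hjp.ne' h'
  have h := auditIndex_eq_card (saleTo_mem_aucΩS w hp) hdev fun G hG =>
    eq_univ_of_detects_saleTo hb hp hpw (fun i hi => (hj' i hi).trans_lt hjp) hG
  simpa using h
end

section
/- Let φ be a social choice mechanism for voting with a binary outcome. Then the worst-case auditability index #φ = 1 if and only if φ is dictatorial. -/
/-! ## Voting with a binary outcome -/

section Voting

variable {N : ℕ}

/-- Feasible voting outcomes: constant profiles over the individuals. -/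
def voteΩS (N : ℕ) : Set (Fin N → Bool) := {ω | ∀ i j, ω i = ω j}

/-- A dictatorial social choice mechanism: some individual's report alone determines
the outcome. -/
def Dictatorial (φ : (Fin N → Bool) → (Fin N → Bool)) : Prop :=
  ∃ i : Fin N, ∀ θ θ' : Fin N → Bool, θ i = θ' i → φ θ = φ θ'

end Voting

/-- Two constant Boolean profiles on voters are equal as soon as they agree at one voter. -/
theorem eq_of_mem_voteΩS {N : ℕ} {ω η : Fin N → Bool} (hω : ω ∈ voteΩS N) (hη : η ∈ voteΩS N)
    {i : Fin N} (h : ω i = η i) : ω = η :=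
  funext fun j => by rw [hω j i, hη j i, h]

/-- A feasible outcome differs from `η` exactly when it is the opposite constant profile. -/
theorem voteΩS_ne_iff {N : ℕ} [NeZero N] {ω η : Fin N → Bool} (hη : η ∈ voteΩS N) :
    ω ∈ voteΩS N ∧ ω ≠ η ↔ ω = fun i => !η i := by
  constructor
  · rintro ⟨hω, hne⟩
    funext i
    by_contra h
    exact hne (eq_of_mem_voteΩS hω hη (i := i) (by simpa using h))
  · rintro rfl
    refine ⟨fun i j => by simp [hη i j], fun h => ?_⟩
    simpa using congrFun h 0

section BinaryVoting

variable {N : ℕ} {φ : (Fin N → Bool) → (Fin N → Bool)}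

theorem detects_not_iff (hφ : ∀ θ, φ θ ∈ voteΩS N) (θ : Fin N → Bool) (G : Finset (Fin N)) :
    Detects Set.univ φ θ (fun i => !φ θ i) G ↔
      G.Nonempty ∧ ∀ θ', (∀ i ∈ G, θ' i = θ i) → φ θ' = φ θ := by
  refine and_congr_right fun ⟨j, hj⟩ => ⟨fun h θ' hθ' => ?_, fun h θ' _ hθ' => ?_⟩
  · obtain ⟨i, -, hi⟩ := h θ' trivial hθ'
    exact eq_of_mem_voteΩS (hφ θ') (hφ θ) (i := i) (by simpa [eq_comm] using hi)
  · exact ⟨j, hj, by simp [h θ' hθ']⟩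

theorem exists_card_eq_minDetect [NeZero N] (hφ : ∀ θ, φ θ ∈ voteΩS N) (θ : Fin N → Bool) :
    ∃ G : Finset (Fin N), G.card = minDetect Set.univ φ θ (fun i => !φ θ i) ∧
      Detects Set.univ φ θ (fun i => !φ θ i) G :=
  Nat.sInf_mem (s := {n | ∃ G : Finset (Fin N), G.card = n ∧
    Detects Set.univ φ θ (fun i => !φ θ i) G})
    ⟨_, Finset.univ, rfl, (detects_not_iff hφ θ _).2
      ⟨Finset.univ_nonempty, fun _ h => congrArg φ (funext fun i => h i (Finset.mem_univ i))⟩⟩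

theorem minDetect_not_pos [NeZero N] (hφ : ∀ θ, φ θ ∈ voteΩS N) (θ : Fin N → Bool) :
    0 < minDetect Set.univ φ θ (fun i => !φ θ i) := by
  obtain ⟨G, hG, hd⟩ := exists_card_eq_minDetect hφ θ
  exact hG ▸ hd.1.card_pos

theorem minDetect_not_eq_one_iff [NeZero N] (hφ : ∀ θ, φ θ ∈ voteΩS N) (θ : Fin N → Bool) :
    minDetect Set.univ φ θ (fun i => !φ θ i) = 1 ↔
      ∃ i, ∀ θ', θ' i = θ i → φ θ' = φ θ := by
  constructor
  · intro h
    obtain ⟨G, hG, hd⟩ := exists_card_eq_minDetect hφ θ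
    obtain ⟨i, rfl⟩ := Finset.card_eq_one.1 (hG.trans h)
    exact ⟨i, by simpa using ((detects_not_iff hφ θ _).1 hd).2⟩
  · rintro ⟨i, hi⟩
    refine le_antisymm (Nat.sInf_le ⟨{i}, rfl, ?_⟩) (minDetect_not_pos hφ θ)
    exact (detects_not_iff hφ θ _).2 ⟨Finset.singleton_nonempty i, by simpa using hi⟩

theorem auditIndex_eq_minDetect_not [NeZero N] (hφ : ∀ θ, φ θ ∈ voteΩS N) (θ : Fin N → Bool) :
    auditIndex (voteΩS N) Set.univ φ θ = minDetect Set.univ φ θ (fun i => !φ θ i) := by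
  simp only [auditIndex, ← and_assoc, voteΩS_ne_iff (hφ θ), exists_eq_left,
    Set.ofPred_eq_eq_singleton', csSup_singleton]

theorem worstIndex_eq_one_iff [NeZero N] (hφ : ∀ θ, φ θ ∈ voteΩS N) :
    worstIndex (voteΩS N) Set.univ φ = 1 ↔ ∀ θ, ∃ i, ∀ θ', θ' i = θ i → φ θ' = φ θ := by
  simp only [← minDetect_not_eq_one_iff hφ, ← auditIndex_eq_minDetect_not hφ]
  have hw : worstIndex (voteΩS N) Set.univ φ = ⨆ θ, auditIndex (voteΩS N) Set.univ φ θ := by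
    simp [worstIndex, iSup, Set.range]
  rw [hw]
  constructor
  · intro h θ
    refine le_antisymm (h ▸ le_ciSup (Set.finite_range _).bddAbove θ) ?_
    exact auditIndex_eq_minDetect_not hφ θ ▸ minDetect_not_pos hφ θ
  · intro h
    simp [h]

/-- If at every problem a single report determines the outcome, then one fixed voter's report
always does. -/
theorem dictatorial_of_forall_exists [NeZero N]
    (h : ∀ θ, ∃ i, ∀ θ', θ' i = θ i → φ θ' = φ θ) : Dictatorial φ := by
  by_cases hc : ∀ θ θ', φ θ = φ θ'
  · exact ⟨0, fun θ θ' _ => hc θ θ'⟩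
  push Not at hc
  obtain ⟨θ, η, hne⟩ := hc
  obtain ⟨i, hi⟩ := h θ
  obtain ⟨j, hj⟩ := h η
  obtain rfl : i = j := by
    by_contra hij
    apply hne
    rw [← hi (Function.update η i (θ i)) (by simp),
      hj _ (Function.update_of_ne (Ne.symm hij) _ _)]
  have hθη : η i ≠ θ i := fun e => hne (hi η e).symm
  refine ⟨i, fun a b hab => ?_⟩
  by_cases ha : a i = θ i
  · rw [hi a ha, hi b (hab ▸ ha)]
  · have ha' : a i = η i := by
      rw [Bool.eq_not_of_ne ha, Bool.eq_not_of_ne hθη]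
    rw [hj a ha', hj b (hab ▸ ha')]

end BinaryVoting

/-- Theorem 5: a social choice mechanism for voting with a binary
outcome has worst-case auditability index `1` iff it is dictatorial. -/
theorem statement14 {N : ℕ}
    (φ : (Fin N → Bool) → (Fin N → Bool))
    (hφ : ∀ θ : Fin N → Bool, φ θ ∈ voteΩS N) :
    worstIndex (voteΩS N) (Set.univ : Set (Fin N → Bool)) φ = 1 ↔ Dictatorial φ := by
  rcases Nat.eq_zero_or_pos N with rfl | hN
  · have h0 : worstIndex (voteΩS 0) Set.univ φ = 0 := by
      simp [worstIndex, auditIndex, eq_iff_true_of_subsingleton]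
    rw [h0]
    exact ⟨fun h => absurd h zero_ne_one, fun ⟨i, _⟩ => i.elim0⟩
  · have : NeZero N := ⟨hN.ne'⟩
    rw [worstIndex_eq_one_iff hφ]
    exact ⟨dictatorial_of_forall_exists,
      fun ⟨i, hi⟩ θ => ⟨i, fun θ' hθ' => hi θ' θ hθ'⟩⟩
end

section
/- Let φ be a serial dictatorship in the house allocation setting with fixed dictator ordering i_1, i_2, …, i_N, let θ be a problem, and for each n ∈ {1,…,N} let Ō_n denote the set of the n most θ_{i_n}-preferred objects of i_n. Then φ has a sequential clinching implementation at θ if and only if Ō_n ⊊ Ō_{n+1} for all n ∈ {1,…,N−1}. -/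
/-- `φ` is the serial dictatorship with the fixed dictator ordering `ord`:
at every problem, the `n`-th dictator `ord n` receives her most preferred object
among those not taken by earlier dictators. -/
def IsSerialDict {N : ℕ} (ord : Fin N → Fin N)
    (φ : (Fin N → (Fin N → Fin N → Prop)) → (Fin N → Fin N)) : Prop :=
  Function.Bijective ord ∧
    ∀ θ ∈ houseΘS N, Function.Bijective (φ θ) ∧
      ∀ n : Fin N, ∀ o, (∀ m : Fin N, m < n → φ θ (ord m) ≠ o) →
        o ≠ φ θ (ord n) → θ (ord n) (φ θ (ord n)) o

/-- The set of the `n` most preferred objects under the strict preference `pref`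
(the objects with fewer than `n` objects strictly above them). -/
def topSet {N : ℕ} (pref : Fin N → Fin N → Prop) (n : ℕ) : Set (Fin N) :=
  {o | Set.ncard {o' | pref o' o} < n}

theorem ncard_above_lt_of_rel {N : ℕ} {r : Fin N → Fin N → Prop}
    (hr : IsStrictTotalOrder (Fin N) r) {a b : Fin N} (h : r a b) :
    Set.ncard {o | r o a} < Set.ncard {o | r o b} := by
  refine Set.ncard_lt_ncard ?_ (Set.toFinite _)
  refine ⟨fun o ho => _root_.trans (r := r) ho h, fun hsub => ?_⟩
  exact irrefl (r := r) a (hsub h)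

theorem ncard_above_injective {N : ℕ} {r : Fin N → Fin N → Prop}
    (hr : IsStrictTotalOrder (Fin N) r) :
    Function.Injective fun a => Set.ncard {o | r o a} := by
  intro a b hab
  rcases trichotomous_of r a b with h | h | h
  · exact absurd hab (ncard_above_lt_of_rel hr h).ne
  · exact h
  · exact absurd hab (ncard_above_lt_of_rel hr h).ne'

theorem ncard_above_lt {N : ℕ} {r : Fin N → Fin N → Prop}
    (hr : IsStrictTotalOrder (Fin N) r) (a : Fin N) : Set.ncard {o | r o a} < N := by
  have h : {o | r o a} ⊂ Set.univ :=
    (Set.ssubset_univ_iff).2 fun h => irrefl (r := r) a (h.symm ▸ Set.mem_univ a : a ∈ {o | r o a})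
  simpa using Set.ncard_lt_ncard h (Set.toFinite _)

theorem ncard_topSet {N : ℕ} {r : Fin N → Fin N → Prop}
    (hr : IsStrictTotalOrder (Fin N) r) {n : ℕ} (hn : n ≤ N) : (topSet r n).ncard = n := by
  let rank : Fin N → Fin N := fun a => ⟨Set.ncard {o | r o a}, ncard_above_lt hr a⟩
  have hinj : Function.Injective rank := fun a b h =>
    ncard_above_injective hr (congrArg Fin.val h)
  have hsurj : Function.Surjective rank := Finite.surjective_of_injective hinj
  have himage : (fun a => Set.ncard {o | r o a}) '' topSet r n = Set.Iio n := by
    ext k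
    constructor
    · rintro ⟨a, ha, rfl⟩
      exact ha
    · intro hk
      obtain ⟨a, ha⟩ := hsurj ⟨k, lt_of_lt_of_le hk hn⟩
      have ha' : Set.ncard {o | r o a} = k := congrArg Fin.val ha
      exact ⟨a, show Set.ncard {o | r o a} < n from ha' ▸ hk, ha'⟩
  rw [← Set.ncard_image_of_injective _ (ncard_above_injective hr), himage]
  simp [Set.ncard_eq_toFinset_card']

/-- Every object is at the top of some strict preference. -/
theorem exists_strictTotalOrder_top {N : ℕ} (o : Fin N) :
    ∃ r : Fin N → Fin N → Prop, IsStrictTotalOrder (Fin N) r ∧ ∀ a, a ≠ o → r o a := by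
  let z : Fin N := ⟨0, o.pos⟩
  let e : Fin N ↪ Fin N := (Equiv.swap o z).toEmbedding
  refine ⟨Order.Preimage e (· < ·), (RelEmbedding.preimage e (· < ·)).isStrictTotalOrder, fun a ha => ?_⟩
  have h0 : e o = z := Equiv.swap_apply_left o z
  have hne : e a ≠ z := fun h => ha (e.injective (h.trans h0.symm))
  change e o < e a
  rw [h0]
  exact lt_of_le_of_ne (Fin.mk_le_of_le_val (Nat.zero_le _)) hne.symm

namespace IsSerialDict

variable {N : ℕ} {ord : Fin N → Fin N}
  {φ : (Fin N → (Fin N → Fin N → Prop)) → (Fin N → Fin N)}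

theorem mem_topSet (hφ : IsSerialDict ord φ) {θ : Fin N → (Fin N → Fin N → Prop)}
    (hθ : θ ∈ houseΘS N) (n : Fin N) : φ θ (ord n) ∈ topSet (θ (ord n)) (n + 1) := by
  have := hθ (ord n)
  have hsub : {o | θ (ord n) o (φ θ (ord n))} ⊆ (fun m => φ θ (ord m)) '' Set.Iio n := by
    intro o ho
    by_contra hnot
    have hfree : ∀ m : Fin N, m < n → φ θ (ord m) ≠ o := fun m hm h => hnot ⟨m, hm, h⟩
    have hne : o ≠ φ θ (ord n) := by
      rintro rfl
      exact irrefl (r := θ (ord n)) _ ho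
    exact asymm (r := θ (ord n)) ho ((hφ.2 θ hθ).2 n o hfree hne)
  have h := (Set.ncard_le_ncard hsub (Set.toFinite _)).trans (Set.ncard_image_le (Set.toFinite _))
  have hn : (Set.Iio n).ncard = n := by simp [Set.ncard_eq_toFinset_card']
  exact Nat.lt_succ_of_le (hn ▸ h)

/-- Each of the first `n + 1` objects of the `n`-th dictator (counting from `0`) is left to her,
and preferred to everything else left, for a suitable choice of the earlier preferences. -/
theorem possible_of_mem_topSet (hφ : IsSerialDict ord φ) {r : Fin N → Fin N → Prop}
    (hr : IsStrictTotalOrder (Fin N) r) {n o : Fin N} (ho : o ∈ topSet r (n + 1)) :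
    Possible (houseΘS N) φ (ord n) r o := by
  classical
  have hcard : (Finset.univ.filter fun o' => r o' o).card ≤ n := by
    have := Nat.lt_succ_iff.1 ho
    simpa [Set.ncard_eq_toFinset_card'] using this
  obtain ⟨V, hUV, hVo, hV⟩ := Finset.exists_subsuperset_card_eq
    (s := Finset.univ.filter fun o' => r o' o) (t := Finset.univ.erase o) (n := n)
    (fun a ha => Finset.mem_erase.2 ⟨by
      rintro rfl
      exact irrefl (r := r) a (Finset.mem_filter.1 ha).2, Finset.mem_univ _⟩)
    hcard (by simp; omega)
  let f : Fin N → Fin N := fun m => if h : m < n then V.orderEmbOfFin hV ⟨m, h⟩ else o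
  choose top htop htop_rel using fun a : Fin N => exists_strictTotalOrder_top a
  let e := Equiv.ofBijective ord hφ.1
  let θ' : Fin N → (Fin N → Fin N → Prop) := fun i => if i = ord n then r else top (f (e.symm i))
  have hθ' : θ' ∈ houseΘS N := by
    intro i
    by_cases hi : i = ord n
    · simpa [θ', hi] using hr
    · simpa [θ', hi] using htop _
  have hself : θ' (ord n) = r := if_pos rfl
  have hearly : ∀ m, m < n → θ' (ord m) = top (f m) := by
    intro m hm
    have : e.symm (ord m) = m := e.symm_apply_apply m
    simp [θ', hφ.1.1.eq_iff, hm.ne, this]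
  obtain ⟨hbij, hbest⟩ := hφ.2 θ' hθ'
  have hf : ∀ m, m < n → φ θ' (ord m) = f m := by
    intro m
    induction m using WellFoundedLT.induction with
    | ind m ih =>
      intro hm
      by_contra hne
      have hpref := hbest m (f m) (fun k hk h => ?_) (Ne.symm hne)
      · have := htop (f m)
        rw [hearly m hm] at hpref
        exact asymm (r := top (f m)) hpref (htop_rel _ _ hne)
      · rw [ih k hk (hk.trans hm)] at h
        simp only [f, hm, hk.trans hm, dif_pos, EmbeddingLike.apply_eq_iff_eq, Fin.mk.injEq] at h
        exact hk.ne (Fin.ext h)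
  refine ⟨θ', hθ', hself, ?_⟩
  by_contra hne
  have hfree : ∀ m : Fin N, m < n → φ θ' (ord m) ≠ o := by
    intro m hm h
    rw [hf m hm] at h
    have hmem : f m ∈ V := by simp [f, hm]
    exact (Finset.mem_erase.1 (hVo hmem)).1 h
  have hpref := hbest n o hfree (Ne.symm hne)
  rw [hself] at hpref
  have hmem : φ θ' (ord n) ∈ V := hUV (by simpa using hpref)
  obtain ⟨k, hk⟩ : φ θ' (ord n) ∈ Set.range (V.orderEmbOfFin hV) := by simpa using hmem
  have hkn : (⟨k, k.2.trans n.2⟩ : Fin N) < n := k.2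
  have hkf : φ θ' (ord ⟨k, k.2.trans n.2⟩) = φ θ' (ord n) := by
    rw [hf _ hkn, ← hk]
    exact dif_pos hkn
  exact hkn.ne (hφ.1.1 (hbij.1 hkf))

theorem possible_iff_mem_topSet (hφ : IsSerialDict ord φ) {r : Fin N → Fin N → Prop}
    (hr : IsStrictTotalOrder (Fin N) r) {n o : Fin N} :
    Possible (houseΘS N) φ (ord n) r o ↔ o ∈ topSet r (n + 1) := by
  refine ⟨?_, hφ.possible_of_mem_topSet hr⟩
  rintro ⟨θ, hθ, rfl, rfl⟩
  exact hφ.mem_topSet hθ n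

end IsSerialDict

theorem Fin.eq_self_of_injective_of_le {N : ℕ} {p : Fin N → Fin N} (hp : Function.Injective p)
    (hle : ∀ t, p t ≤ t) (t : Fin N) : p t = t := by
  induction t using WellFoundedLT.induction with
  | ind t ih =>
    by_contra hne
    exact hne (hp (ih _ (lt_of_le_of_ne (hle t) hne)))

/-- Lemma 2: a serial dictatorship `φ` with dictator ordering
`i_1, …, i_N` has a sequential clinching implementation at `θ` iff
`Ō_n ⊊ Ō_{n+1}` for all `n ∈ {1, …, N−1}`, where `Ō_n` is the set of the `n` most
`θ_{i_n}`-preferred objects. -/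
theorem statement18 {N : ℕ} (hN : 2 ≤ N)
    (ord : Fin N → Fin N)
    (φ : (Fin N → (Fin N → Fin N → Prop)) → (Fin N → Fin N))
    (hφ : IsSerialDict ord φ)
    (θ : Fin N → (Fin N → Fin N → Prop)) (hθ : θ ∈ houseΘS N) :
    SeqClinching (houseΘS N) φ θ ↔
      ∀ n : ℕ, ∀ h1 : n + 1 < N,
        topSet (θ (ord ⟨n, by omega⟩)) (n + 1) ⊂
          topSet (θ (ord ⟨n + 1, h1⟩)) (n + 2) := by
  obtain ⟨hbij, -⟩ := hφ.2 θ hθ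
  have hinj : Function.Injective fun m => φ θ (ord m) := hbij.1.comp hφ.1.1
  constructor
  · rintro ⟨σ, hσ, hclinch⟩
    let e := Equiv.ofBijective ord hφ.1
    let p : Fin N → Fin N := fun t => e.symm (σ t)
    have hord : ∀ t, ord (p t) = σ t := fun t => e.apply_symm_apply (σ t)
    have hsub : ∀ t, topSet (θ (σ t)) (p t + 1) ⊆ (fun s => φ θ (σ s)) '' Set.Iic t := by
      intro t o ho
      by_contra hnot
      have hposs : Possible (houseΘS N) φ (σ t) (θ (σ t)) o := by
        have := (hφ.possible_iff_mem_topSet (hθ (σ t)) (n := p t)).2 ho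
        rwa [hord] at this
      have heq := (hclinch t).2.2 o (fun s hs h => hnot ⟨s, hs.le, h⟩) hposs
      exact hnot ⟨t, le_refl t, heq.symm⟩
    have hcard : ∀ t : Fin N, ((fun s => φ θ (σ s)) '' Set.Iic t).ncard = t + 1 := by
      intro t
      rw [Set.ncard_image_of_injective (f := fun s => φ θ (σ s)) _ (hbij.1.comp hσ.1)]
      simp [Set.ncard_eq_toFinset_card']
    have hp : ∀ t, p t = t := by
      refine Fin.eq_self_of_injective_of_le (e.symm.injective.comp hσ.1) fun t => ?_
      have h := Set.ncard_le_ncard (hsub t) (Set.toFinite _)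
      rw [hcard, ncard_topSet (hθ (σ t)) (p t).2] at h
      exact Fin.le_def.2 (Nat.succ_le_succ_iff.1 h)
    have htop : ∀ t : Fin N,
        topSet (θ (ord t)) (t + 1) = (fun m => φ θ (ord m)) '' Set.Iic t := by
      obtain rfl : σ = ord := funext fun t => by rw [← hord, hp]
      intro t
      refine Set.eq_of_subset_of_ncard_le ?_ ?_ (Set.toFinite _)
      · simpa only [hp] using hsub t
      · rw [hcard, ncard_topSet (hθ _) t.2]
    intro n h1
    have hn := htop ⟨n, by omega⟩
    have hn1 := htop ⟨n + 1, h1⟩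
    simp only at hn hn1
    rw [hn, hn1]
    exact hinj.image_strictMono (Set.Iic_ssubset_Iic.2 (Fin.mk_lt_mk.2 n.lt_succ_self))
  · intro hchain
    have hmono : ∀ n m : Fin N, m ≤ n →
        topSet (θ (ord m)) (m + 1) ⊆ topSet (θ (ord n)) (n + 1) := by
      rintro ⟨n, hn⟩ ⟨m, hm⟩ hmn
      replace hmn : m ≤ n := hmn
      induction n, hmn using Nat.le_induction with
      | base => exact subset_rfl
      | succ k hk ih => exact (ih (by omega)).trans (hchain k hn).subset
    have htop : ∀ t : Fin N,
        (fun m => φ θ (ord m)) '' Set.Iic t = topSet (θ (ord t)) (t + 1) := by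
      intro t
      refine Set.eq_of_subset_of_ncard_le ?_ ?_ (Set.toFinite _)
      · rintro _ ⟨m, hm, rfl⟩
        exact hmono t m hm (hφ.mem_topSet hθ m)
      · rw [ncard_topSet (hθ _) t.2, Set.ncard_image_of_injective _ hinj]
        simp [Set.ncard_eq_toFinset_card']
    refine ⟨ord, hφ.1, fun t => ⟨fun s hs h => hs.ne (hinj h), ⟨θ, hθ, rfl, rfl⟩, ?_⟩⟩
    intro o hfree hposs
    rw [hφ.possible_iff_mem_topSet (hθ _), ← htop] at hposs
    obtain ⟨m, hm, rfl⟩ := hposs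
    rcases (Set.mem_Iic.1 hm).lt_or_eq with hlt | rfl
    · exact absurd rfl (hfree m hlt)
    · rfl
end

section
/- For each N ≥ 2, let φ_N be the serial dictatorship on N individuals and N objects with a fixed dictator ordering i_1, …, i_N. Then the proportion of problems θ (among all N-tuples of strict preferences over the N objects) for which the auditability index #φ_N^θ = 1 converges to zero as N → ∞. Equivalently (by the clinching characterization), the fraction of preference profiles θ for which the sets Ō_n of the n most θ_{i_n}-preferred objects of i_n satisfy Ō_n ⊊ Ō_{n+1} for all n ∈ {1,…,N−1} tends to 0 as N → ∞. -/
section SerialDictatorship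

variable {N : ℕ} {ord : Fin N → Fin N}
  {φ : (Fin N → (Fin N → Fin N → Prop)) → (Fin N → Fin N)}

/-- If the auditability index is `1`, every deviation is detected by a single individual. -/
theorem exists_detects_singleton_of_auditIndex_eq_one {ι : Type*} [Fintype ι] [DecidableEq ι]
    {Θi Ωi : ι → Type*} {ΩS : Set (∀ i, Ωi i)} {ΘS : Set (∀ i, Θi i)}
    {φ : (∀ i, Θi i) → (∀ i, Ωi i)} {θ : ∀ i, Θi i} (h : auditIndex ΩS ΘS φ θ = 1)
    {ω : ∀ i, Ωi i} (hω : ω ∈ ΩS) (hne : ω ≠ φ θ) :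
    ∃ i, Detects ΘS φ θ ω {i} := by
  have hbdd : BddAbove {n | ∃ ω ∈ ΩS, ω ≠ φ θ ∧ minDetect ΘS φ θ ω = n} := by
    by_contra hb
    have := Nat.sSup_of_not_bddAbove hb
    unfold auditIndex at h
    omega
  have hle : minDetect ΘS φ θ ω ≤ 1 := h ▸ le_csSup hbdd ⟨ω, hω, hne, rfl⟩
  obtain ⟨i₀, hi₀⟩ := Function.ne_iff.mp hne
  have huniv : Detects ΘS φ θ ω Finset.univ := by
    refine ⟨⟨i₀, Finset.mem_univ _⟩, fun θ' _ heq => ⟨i₀, Finset.mem_univ _, ?_⟩⟩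
    rwa [show θ' = θ from funext fun i => heq i (Finset.mem_univ i)]
  obtain ⟨G, hcard, hG⟩ : minDetect ΘS φ θ ω ∈
      {n | ∃ G : Finset ι, G.card = n ∧ Detects ΘS φ θ ω G} :=
    Nat.sInf_mem ⟨_, Finset.univ, rfl, huniv⟩
  obtain ⟨i, rfl⟩ := Finset.card_eq_one.mp
    (le_antisymm (hcard.trans_le hle) (Finset.card_pos.mpr hG.1))
  exact ⟨i, hG⟩

/-- Every object is the top of some strict preference. -/
theorem exists_strictPref_with_top (x : Fin N) :
    ∃ r : Fin N → Fin N → Prop, IsStrictTotalOrder (Fin N) r ∧ ∀ o, o ≠ x → r x o := by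
  have : NeZero N := ⟨fun h => (h ▸ x).elim0⟩
  refine ⟨Function.onFun (· < ·) (Equiv.swap 0 x),
    (Equiv.swap 0 x).injective.isStrictTotalOrder_onFun _, fun o ho => ?_⟩
  simp only [Function.onFun, Equiv.swap_apply_right]
  refine Fin.pos_iff_ne_zero.mpr fun h => ho ?_
  exact (Equiv.swap 0 x).injective (h.trans (Equiv.swap_apply_right 0 x).symm)

/-- The serial dictatorship outcome is the only bijection in which every dictator prefers
her object to those of all later dictators. -/
theorem IsSerialDict.eq_of_prefers_later (h : IsSerialDict ord φ)
    {θ : Fin N → (Fin N → Fin N → Prop)} (hθ : θ ∈ houseΘS N) {f : Fin N → Fin N}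
    (hf : Function.Bijective f)
    (hpref : ∀ n m, n < m → θ (ord n) (f (ord n)) (f (ord m))) : φ θ = f := by
  obtain ⟨hord, hφ⟩ := h
  obtain ⟨-, hrun⟩ := hφ θ hθ
  suffices ∀ n, φ θ (ord n) = f (ord n) by
    funext i
    obtain ⟨n, rfl⟩ := hord.2 i
    exact this n
  intro n
  induction n using WellFoundedLT.induction with
  | _ n ih =>
    by_contra hne
    have hbij : Function.Bijective (φ θ) := (hφ θ hθ).1
    have hbest := hrun n (f (ord n))
      (fun m hm heq => hm.ne (hord.1 (hf.1 ((ih m hm).symm.trans heq)))) (Ne.symm hne)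
    obtain ⟨j, hj⟩ := (hf.comp hord).2 (φ θ (ord n))
    rw [Function.comp_apply] at hj
    have := hθ (ord n)
    rcases lt_trichotomy j n with hjn | rfl | hjn
    · exact hjn.ne (hord.1 (hbij.1 ((ih j hjn).trans hj)))
    · exact hne hj.symm
    · exact asymm hbest (hj ▸ hpref n j hjn)

/-- The dictator at step `n` cannot detect on her own that she receives `f (ord n)` if she
prefers it to all that `f` leaves for later dictators. -/
theorem IsSerialDict.not_detects_singleton (h : IsSerialDict ord φ)
    {θ : Fin N → (Fin N → Fin N → Prop)} (hθ : θ ∈ houseΘS N) {ω f : Fin N → Fin N}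
    (hf : Function.Bijective f) {n : Fin N} (hn : f (ord n) = ω (ord n))
    (hpref : ∀ m, n < m → θ (ord n) (f (ord n)) (f (ord m))) :
    ¬ Detects (houseΘS N) φ θ ω {ord n} := by
  rintro ⟨-, hdet⟩
  choose r hr hrtop using exists_strictPref_with_top (N := N)
  set θ' : Fin N → (Fin N → Fin N → Prop) :=
    Function.update (fun i => r (f i)) (ord n) (θ (ord n))
  have hself : θ' (ord n) = θ (ord n) := by simp [θ']
  have hother : ∀ i, i ≠ ord n → θ' i = r (f i) := fun i hi => by simp [θ', hi]
  have hθ' : θ' ∈ houseΘS N := by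
    intro i
    by_cases hi : i = ord n
    · rw [hi, hself]; exact hθ _
    · rw [hother i hi]; exact hr _
  have hφf : φ θ' = f := by
    refine h.eq_of_prefers_later hθ' hf fun j m hjm => ?_
    by_cases hj : ord j = ord n
    · obtain rfl := h.1.1 hj
      rw [hself]
      exact hpref m hjm
    · rw [hother _ hj]
      exact hrtop _ _ fun heq => hjm.ne' (h.1.1 (hf.1 heq))
  obtain ⟨i, hi, hne⟩ := hdet θ' hθ' fun i hi => by rw [Finset.mem_singleton.mp hi, hself]
  rw [Finset.mem_singleton.mp hi, hφf, hn] at hne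
  exact hne rfl

/-- If the auditability index is `1`, the last dictator receives the object that the
penultimate dictator likes least. -/
theorem IsSerialDict.worst_of_auditIndex_eq_one (h : IsSerialDict ord φ)
    {k l : Fin N} (hkl : k < l) (hlast : ∀ m, k < m → m = l)
    {θ : Fin N → (Fin N → Fin N → Prop)} (hθ : θ ∈ houseΘS N)
    (hindex : auditIndex (allocΩS N) (houseΘS N) φ θ = 1) (o : Fin N)
    (ho : o ≠ φ θ (ord l)) : θ (ord k) o (φ θ (ord l)) := by
  have hsto := hθ (ord k)
  obtain ⟨hbij, hrun⟩ := h.2 θ hθ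
  by_contra hno
  have hao : θ (ord k) (φ θ (ord l)) o :=
    (trichotomous_of (θ (ord k)) (φ θ (ord l)) o).resolve_right
      (not_or.mpr ⟨ho.symm, hno⟩)
  have hlk : ord l ≠ ord k := fun heq => hkl.ne' (h.1.1 heq)
  have hba : φ θ (ord l) ≠ φ θ (ord k) := fun heq => hlk (hbij.1 heq)
  set ω : Fin N → Fin N := φ θ ∘ Equiv.swap (ord k) (ord l) with hω_def
  have hωk : ω (ord k) = φ θ (ord l) := by simp [ω]
  have hωl : ω (ord l) = φ θ (ord k) := by simp [ω]
  have hω : Function.Bijective ω := hbij.comp (Equiv.bijective _)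
  obtain ⟨i, hi⟩ := exists_detects_singleton_of_auditIndex_eq_one hindex (ω := ω) hω
    fun heq => hba (hωk.symm.trans (congrFun heq _))
  obtain ⟨n, rfl⟩ := h.1.2 i
  by_cases hnl : n = l
  · subst hnl
    exact h.not_detects_singleton hθ hω rfl
      (fun m hm => absurd (hlast m (hkl.trans hm)) hm.ne') hi
  by_cases hnk : n = k
  · subst hnk
    have hfk : (Equiv.swap o (φ θ (ord n)) ∘ ω) (ord n) = ω (ord n) := by
      rw [Function.comp_apply, hωk, Equiv.swap_apply_of_ne_of_ne ho.symm hba]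
    refine h.not_detects_singleton hθ (f := Equiv.swap o (φ θ (ord n)) ∘ ω)
      ((Equiv.bijective _).comp hω) hfk (fun m hm => ?_) hi
    rw [hfk, hlast m hm, Function.comp_apply, hωk, hωl, Equiv.swap_apply_right]
    exact hao
  · refine h.not_detects_singleton hθ (f := φ θ) hbij ?_ (fun m hm => ?_) hi
    · rw [hω_def, Function.comp_apply, Equiv.swap_apply_of_ne_of_ne
        (fun heq => hnk (h.1.1 heq)) (fun heq => hnl (h.1.1 heq))]
    · exact hrun n _ (fun j hj heq => (hj.trans hm).ne (h.1.1 (hbij.1 heq)))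
        fun heq => hm.ne' (h.1.1 (hbij.1 heq))

/-- The objects taken before step `k` do not depend on the preference of the dictator at
step `k`. -/
theorem IsSerialDict.eq_before (h : IsSerialDict ord φ)
    {θ θ' : Fin N → (Fin N → Fin N → Prop)} (hθ : θ ∈ houseΘS N) (hθ' : θ' ∈ houseΘS N)
    {k : Fin N} (hagree : ∀ i, i ≠ ord k → θ i = θ' i) (n : Fin N) (hn : n < k) :
    φ θ (ord n) = φ θ' (ord n) := by
  induction n using WellFoundedLT.induction with
  | _ n ih =>
    obtain ⟨hbij, hrun⟩ := h.2 θ hθ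
    obtain ⟨hbij', hrun'⟩ := h.2 θ' hθ'
    by_contra hne
    have h₁ := hrun n (φ θ' (ord n)) (fun m hm heq => hm.ne (h.1.1 (hbij'.1
      ((ih m hm (hm.trans hn)).symm.trans heq)))) (Ne.symm hne)
    have h₂ := hrun' n (φ θ (ord n)) (fun m hm heq => hm.ne (h.1.1 (hbij.1
      ((ih m hm (hm.trans hn)).trans heq)))) hne
    rw [← hagree _ fun heq => hn.ne (h.1.1 heq)] at h₂
    have := hθ (ord n)
    exact asymm h₁ h₂

/-- Changing the preference of the penultimate dictator can at most hand the last dictator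
the object that the penultimate one received. -/
theorem IsSerialDict.last_mem_pair (h : IsSerialDict ord φ)
    {k l : Fin N} (hlast : ∀ m, k < m → m = l)
    {θ θ' : Fin N → (Fin N → Fin N → Prop)} (hθ : θ ∈ houseΘS N) (hθ' : θ' ∈ houseΘS N)
    (hkl : k < l) (hagree : ∀ i, i ≠ ord k → θ i = θ' i) :
    φ θ (ord l) = φ θ' (ord k) ∨ φ θ (ord l) = φ θ' (ord l) := by
  obtain ⟨j, hj⟩ := ((h.2 θ' hθ').1.comp h.1).2 (φ θ (ord l))
  rw [Function.comp_apply] at hj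
  rcases lt_trichotomy j k with hjk | rfl | hjk
  · rw [← h.eq_before hθ hθ' hagree j hjk] at hj
    exact absurd (h.1.1 ((h.2 θ hθ).1.1 hj)) (hjk.trans hkl).ne
  · exact Or.inl hj.symm
  · exact Or.inr (hlast j hjk ▸ hj.symm)

/-- Relabel the objects in the preference of individual `i` by translation by `c`. -/
def shiftPref [NeZero N] (i : Fin N) (c : Fin N) (θ : Fin N → (Fin N → Fin N → Prop)) :
    Fin N → (Fin N → Fin N → Prop) :=
  Function.update θ i fun a b => θ i (a - c) (b - c)

theorem shiftPref_self [NeZero N] (i c : Fin N) (θ : Fin N → (Fin N → Fin N → Prop)) :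
    shiftPref i c θ i = fun a b => θ i (a - c) (b - c) :=
  Function.update_self ..

theorem shiftPref_of_ne [NeZero N] {i j : Fin N} (hj : j ≠ i) (c : Fin N)
    (θ : Fin N → (Fin N → Fin N → Prop)) : shiftPref i c θ j = θ j :=
  Function.update_of_ne hj ..

theorem shiftPref_injective [NeZero N] (i c : Fin N) : Function.Injective (shiftPref i c) := by
  intro θ θ' heq
  funext j
  by_cases hj : j = i
  · subst hj
    funext a b
    have := congrFun (congrFun (congrFun heq j) (a + c)) (b + c)
    simpa [shiftPref_self] using this
  · simpa [shiftPref_of_ne hj] using congrFun heq j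

theorem shiftPref_mem_houseΘS [NeZero N] (i c : Fin N)
    {θ : Fin N → (Fin N → Fin N → Prop)} (hθ : θ ∈ houseΘS N) :
    shiftPref i c θ ∈ houseΘS N := by
  intro j
  by_cases hj : j = i
  · subst hj
    rw [shiftPref_self]
    have := hθ j
    exact (sub_left_injective (b := c)).isStrictTotalOrder_onFun (θ j)
  · rw [shiftPref_of_ne hj]
    exact hθ j

/-- At most a fraction `2 / N` of all problems have auditability index `1`. -/
theorem IsSerialDict.mul_ncard_auditIndex_eq_one_le [NeZero N] (h : IsSerialDict ord φ)
    {k l : Fin N} (hkl : k < l) (hlast : ∀ m, k < m → m = l) :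
    {θ ∈ houseΘS N | auditIndex (allocΩS N) (houseΘS N) φ θ = 1}.ncard * N ≤
      2 * (houseΘS N).ncard := by
  classical
  set B := {θ ∈ houseΘS N | auditIndex (allocΩS N) (houseΘS N) φ θ = 1}
  have hB : B.Finite := Set.toFinite _
  have hH : (houseΘS N).Finite := Set.toFinite _
  rw [Set.ncard_eq_toFinset_card B hB, Set.ncard_eq_toFinset_card _ hH]
  have hcard : (hB.toFinset ×ˢ (Finset.univ : Finset (Fin N))).card =
      hB.toFinset.card * N := by simp
  rw [← hcard]
  refine Finset.card_le_mul_card_image_of_maps_to (f := fun p => shiftPref (ord k) p.2 p.1)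
    ?_ 2 ?_
  · rintro ⟨θ, c⟩ hp
    simp only [Finset.mem_product, Set.Finite.mem_toFinset] at hp ⊢
    exact shiftPref_mem_houseΘS _ _ hp.1.1
  · intro η hη
    rw [Set.Finite.mem_toFinset] at hη
    refine le_trans (Finset.card_le_card_of_injOn (t := {φ η (ord k), φ η (ord l)})
      (fun p => φ p.1 (ord l)) ?_ ?_) Finset.card_le_two
    · rintro ⟨θ, c⟩ hp
      simp only [Finset.coe_filter, Finset.mem_product, Set.Finite.mem_toFinset,
        Set.mem_ofPred_eq] at hp
      obtain ⟨⟨hθ, -⟩, rfl⟩ := hp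
      simpa using h.last_mem_pair hlast hθ.1 hη hkl
        fun i hi => (shiftPref_of_ne hi c θ).symm
    · have hworst : ∀ θ ∈ B, ∀ c, shiftPref (ord k) c θ = η →
          ∀ o, o ≠ φ θ (ord l) + c → η (ord k) o (φ θ (ord l) + c) := by
        rintro θ hθ c rfl o ho
        rw [shiftPref_self]
        simpa using h.worst_of_auditIndex_eq_one hkl hlast hθ.1 hθ.2 (o - c)
          fun heq => ho (sub_eq_iff_eq_add.mp heq)
      rintro ⟨θ₁, c₁⟩ hp₁ ⟨θ₂, c₂⟩ hp₂ heq
      simp only [Finset.coe_filter, Finset.mem_product, Set.Finite.mem_toFinset,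
        Set.mem_ofPred_eq] at hp₁ hp₂ heq
      obtain ⟨⟨hθ₁, -⟩, hs₁⟩ := hp₁
      obtain ⟨⟨hθ₂, -⟩, hs₂⟩ := hp₂
      have hc : c₁ = c₂ := by
        by_contra hne
        have hne' : φ θ₁ (ord l) + c₁ ≠ φ θ₂ (ord l) + c₂ := by
          rw [heq]
          exact fun h' => hne (add_left_cancel h')
        have := hη (ord k)
        exact asymm (hworst θ₁ hθ₁ c₁ hs₁ _ hne'.symm) (hworst θ₂ hθ₂ c₂ hs₂ _ hne')
      subst hc
      rw [shiftPref_injective _ _ (hs₁.trans hs₂.symm)]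

end SerialDictatorship

open Filter in
/-- Proposition 6: for a family of serial dictatorships `φ N`
(one for each market size `N`, with fixed dictator orderings `ord N`), the proportion
of problems `θ` at which the auditability index equals `1` goes to `0`
as `N → ∞`. -/
theorem statement19
    (φ : ∀ N : ℕ, (Fin N → (Fin N → Fin N → Prop)) → (Fin N → Fin N))
    (ord : ∀ N : ℕ, Fin N → Fin N)
    (h : ∀ N : ℕ, 2 ≤ N → IsSerialDict (ord N) (φ N)) :
    Tendsto (fun N : ℕ =>
        ((Set.ncard {θ ∈ houseΘS N |
            auditIndex (allocΩS N) (houseΘS N) (φ N) θ = 1} : ℝ) /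
          (Set.ncard (houseΘS N) : ℝ)))
      atTop (nhds 0) := by
  refine squeeze_zero' (Eventually.of_forall fun N => by positivity) ?_
    (tendsto_const_div_atTop_nhds_zero_nat (2 : ℝ))
  filter_upwards [eventually_ge_atTop 2] with N hN
  have : NeZero N := ⟨by omega⟩
  have hbound := (h N hN).mul_ncard_auditIndex_eq_one_le (k := ⟨N - 2, by omega⟩)
    (l := ⟨N - 1, by omega⟩) (Fin.mk_lt_mk.mpr (by omega)) fun m hm => by
      rw [Fin.lt_def] at hm
      ext
      have := m.isLt
      simp only at hm ⊢
      omega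
  refine div_le_of_le_mul₀ (by positivity) (by positivity) ?_
  have hpos : (0 : ℝ) < N := by exact_mod_cast (by omega : 0 < N)
  rw [div_mul_eq_mul_div, le_div_iff₀ hpos]
  exact_mod_cast hbound
end
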